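/- arXiv:2208.10650 — 6 statements merged into one kernel-verified Lean document; each statement's English description precedes it below -/
import Mathlib

section
/- In the first-price auction with machine-learned reserves of accuracy γ ∈ [0,1], for every equilibrium strategy profile: (1 − γ) · Σ_{i ∈ B_v} E[val i] + Σ over all bidders i and auctions j with rw(j) ∈ B_v of E[p i j] ≥ Σ over all auctions j with rw(j) ∈ B_v of max_i v i j. -/
open MeasureTheory Finset
open scoped Classical

namespace FPAR

variable {n m : ℕ}

/-- Bidder `i` wins auction `j` under bid profile `b` with reserves `r`: `i` bids at
least the reserve and has the highest bid among those meeting the reserve, ties broken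
in favor of larger value, then smaller index. -/
def Wins (v b : Fin n → Fin m → ℝ) (r : Fin m → ℝ) (j : Fin m) (i : Fin n) : Prop :=
  r j ≤ b i j ∧ ∀ i', i' ≠ i →
    b i' j < r j ∨ b i' j < b i j ∨
      (b i' j = b i j ∧ (v i' j < v i j ∨ (v i' j = v i j ∧ i < i')))

/-- Indicator that bidder `i` wins auction `j`. -/
noncomputable def xind (v b : Fin n → Fin m → ℝ) (r : Fin m → ℝ) (j : Fin m) (i : Fin n) : ℝ :=
  if Wins v b r j i then 1 else 0

noncomputable def valij (v b : Fin n → Fin m → ℝ) (r : Fin m → ℝ) (i : Fin n) (j : Fin m) : ℝ :=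
  xind v b r j i * v i j

noncomputable def payij (v b : Fin n → Fin m → ℝ) (r : Fin m → ℝ) (i : Fin n) (j : Fin m) : ℝ :=
  xind v b r j i * b i j

/-- Admissible strategy: probability distribution over nonnegative bid vectors
with finite expectations. -/
def Admissible (σ : Measure (Fin m → ℝ)) : Prop :=
  IsProbabilityMeasure σ ∧ (∀ᵐ β ∂σ, ∀ j, 0 ≤ β j) ∧ ∀ j, Integrable (fun β => β j) σ

noncomputable def EValij (v : Fin n → Fin m → ℝ) (r : Fin m → ℝ)
    (μ : Fin n → Measure (Fin m → ℝ)) (i : Fin n) (j : Fin m) : ℝ :=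
  ∫ b, valij v b r i j ∂(Measure.pi μ)

noncomputable def EPayij (v : Fin n → Fin m → ℝ) (r : Fin m → ℝ)
    (μ : Fin n → Measure (Fin m → ℝ)) (i : Fin n) (j : Fin m) : ℝ :=
  ∫ b, payij v b r i j ∂(Measure.pi μ)

noncomputable def EVal (v : Fin n → Fin m → ℝ) (r : Fin m → ℝ)
    (μ : Fin n → Measure (Fin m → ℝ)) (i : Fin n) : ℝ :=
  ∑ j, EValij v r μ i j

noncomputable def EPay (v : Fin n → Fin m → ℝ) (r : Fin m → ℝ)
    (μ : Fin n → Measure (Fin m → ℝ)) (i : Fin n) : ℝ :=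
  ∑ j, EPayij v r μ i j

noncomputable def EUtil (v : Fin n → Fin m → ℝ) (r : Fin m → ℝ)
    (μ : Fin n → Measure (Fin m → ℝ)) (i : Fin n) : ℝ :=
  EVal v r μ i - EPay v r μ i

/-- A utility maximizer best responds: no admissible deviation improves expected utility. -/
def UtilBest (v : Fin n → Fin m → ℝ) (r : Fin m → ℝ)
    (μ : Fin n → Measure (Fin m → ℝ)) (i : Fin n) : Prop :=
  ∀ σ, Admissible σ → EUtil v r (Function.update μ i σ) i ≤ EUtil v r μ i

/-- A value maximizer best responds: its ROI constraint holds and no admissible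
deviation satisfying the ROI constraint yields more expected value. -/
def ValBest (v : Fin n → Fin m → ℝ) (r : Fin m → ℝ)
    (μ : Fin n → Measure (Fin m → ℝ)) (i : Fin n) : Prop :=
  EPay v r μ i ≤ EVal v r μ i ∧
    ∀ σ, Admissible σ →
      EPay v r (Function.update μ i σ) i ≤ EVal v r (Function.update μ i σ) i →
      EVal v r (Function.update μ i σ) i ≤ EVal v r μ i

/-- Equilibrium: all strategies admissible, every utility maximizer in `Bu` and
every value maximizer in `Bv` best responds. -/
def Equilibrium (v : Fin n → Fin m → ℝ) (r : Fin m → ℝ) (Bu Bv : Finset (Fin n))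
    (μ : Fin n → Measure (Fin m → ℝ)) : Prop :=
  (∀ i, Admissible (μ i)) ∧ (∀ i ∈ Bu, UtilBest v r μ i) ∧ (∀ i ∈ Bv, ValBest v r μ i)

/-- The rightful winner of auction `j`: the bidder with the highest value,
ties broken toward the smaller index. -/
noncomputable def rwinner [NeZero n] (v : Fin n → Fin m → ℝ) (j : Fin m) : Fin n :=
  (Finset.univ.filter fun i => ∀ i', v i' j ≤ v i j).min' (by
    obtain ⟨i, -, hi⟩ := Finset.exists_max_image (Finset.univ : Finset (Fin n))
      (fun i => v i j) Finset.univ_nonempty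
    exact ⟨i, Finset.mem_filter.mpr ⟨Finset.mem_univ _, fun i' => hi i' (Finset.mem_univ _)⟩⟩)

end FPAR

open MeasureTheory Finset

namespace FPAR

variable {n m : ℕ} {v : Fin n → Fin m → ℝ} {r : Fin m → ℝ} {μ : Fin n → Measure (Fin m → ℝ)}

/-- No bidder meets the reserve of auction `j`. -/
def Unsold (b : Fin n → Fin m → ℝ) (r : Fin m → ℝ) (j : Fin m) : Prop :=
  ∀ i, b i j < r j

/-- The bid profile in which bidder `i` replaces its bid vector `β` by `T β`. -/
def deviate (i : Fin n) (T : (Fin m → ℝ) → Fin m → ℝ) (b : Fin n → Fin m → ℝ) :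
    Fin n → Fin m → ℝ :=
  Function.update b i (T (b i))

/-- The strategy profile in which bidder `i` replaces its bid vector `β` by `T β`. -/
noncomputable def deviateStrategy (i : Fin n) (T : (Fin m → ℝ) → Fin m → ℝ)
    (μ : Fin n → Measure (Fin m → ℝ)) : Fin n → Measure (Fin m → ℝ) :=
  Function.update μ i ((μ i).map T)

@[simp]
lemma deviate_self (i : Fin n) (T : (Fin m → ℝ) → Fin m → ℝ) (b : Fin n → Fin m → ℝ) (j : Fin m) :
    deviate i T b i j = T (b i) j := by
  simp [deviate]

lemma deviate_of_ne {i i' : Fin n} (h : i' ≠ i) (T : (Fin m → ℝ) → Fin m → ℝ)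
    (b : Fin n → Fin m → ℝ) (j : Fin m) : deviate i T b i' j = b i' j := by
  simp [deviate, h]

lemma xind_nonneg (b : Fin n → Fin m → ℝ) (j : Fin m) (i : Fin n) : 0 ≤ xind v b r j i := by
  unfold xind; split_ifs <;> norm_num

lemma xind_le_one (b : Fin n → Fin m → ℝ) (j : Fin m) (i : Fin n) : xind v b r j i ≤ 1 := by
  unfold xind; split_ifs <;> norm_num

lemma valij_nonneg (hv : ∀ i j, 0 ≤ v i j) (b : Fin n → Fin m → ℝ) (i : Fin n) (j : Fin m) :
    0 ≤ valij v b r i j :=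
  mul_nonneg (xind_nonneg b j i) (hv i j)

lemma payij_nonneg (hr : ∀ j, 0 ≤ r j) (b : Fin n → Fin m → ℝ) (i : Fin n) (j : Fin m) :
    0 ≤ payij v b r i j := by
  unfold payij xind
  split_ifs with h
  · simpa using (hr j).trans h.1
  · simp

/-- The outcome of auction `j` depends only on the bids in auction `j`. -/
lemma xind_congr {b b' : Fin n → Fin m → ℝ} {j : Fin m} (h : ∀ i, b i j = b' i j) (i : Fin n) :
    xind v b r j i = xind v b' r j i := by
  have : Wins v b r j i ↔ Wins v b' r j i := by simp only [Wins, h]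
  simp only [xind, this]

lemma exists_wins {b : Fin n → Fin m → ℝ} {j : Fin m} (h : ¬ Unsold b r j) :
    ∃ i, Wins v b r j i := by
  simp only [Unsold, not_forall, not_lt] at h
  obtain ⟨i₀, hi₀⟩ := h
  obtain ⟨i, hi, hmax⟩ := Finset.exists_max_image (univ.filter fun i => r j ≤ b i j)
    (fun i => toLex (b i j, toLex (v i j, OrderDual.toDual i))) ⟨i₀, by simpa using hi₀⟩
  refine ⟨i, by simpa using hi, fun i' hne => ?_⟩
  by_cases hlt : b i' j < r j
  · exact Or.inl hlt
  have hle := hmax i' (by simpa using hlt)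
  simp only [Prod.Lex.le_iff, ofLex_toLex, OrderDual.toDual_le_toDual] at hle
  rcases hle with h | ⟨h, h' | ⟨h', h''⟩⟩
  · exact Or.inr (Or.inl h)
  · exact Or.inr (Or.inr ⟨h, Or.inl h'⟩)
  · exact Or.inr (Or.inr ⟨h, Or.inr ⟨h', lt_of_le_of_ne h'' hne.symm⟩⟩)

lemma Wins.le_sum_payij {b : Fin n → Fin m → ℝ} {j : Fin m} {i : Fin n} (h : Wins v b r j i)
    (hr : ∀ j, 0 ≤ r j) : b i j ≤ ∑ i', payij v b r i' j :=
  calc b i j = payij v b r i j := by simp [payij, xind, h]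
    _ ≤ ∑ i', payij v b r i' j :=
      Finset.single_le_sum (f := fun i' => payij v b r i' j)
        (fun i' _ => payij_nonneg hr b i' j) (Finset.mem_univ i)

/-- An auction with an eligible bid `b i j` collects at least that bid. -/
lemma bid_le_sum_payij (hr : ∀ j, 0 ≤ r j) {b : Fin n → Fin m → ℝ} {j : Fin m} {i : Fin n}
    (h : r j ≤ b i j) : b i j ≤ ∑ i', payij v b r i' j := by
  obtain ⟨w, hw⟩ := exists_wins (v := v) (b := b) (r := r) (j := j)
    (fun hu => absurd (hu i) (not_lt.mpr h))
  refine le_trans ?_ (hw.le_sum_payij hr)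
  rcases eq_or_ne i w with rfl | hne
  · exact le_rfl
  · rcases hw.2 i hne with hlow | hlt | htie
    · exact absurd hlow (not_lt.mpr h)
    · exact hlt.le
    · exact htie.1.le

/-- If `i` bids its full value in an auction where its value is at least the reserve, then
the discounted value it wins and the revenue without the deviation cover that value, except
when the auction was unsold. -/
lemma le_valij_deviate_add_sum_payij {γ : ℝ} (hγ : γ ≤ 1) (hv : ∀ i j, 0 ≤ v i j)
    (hr : ∀ j, 0 ≤ r j) {i : Fin n} {j : Fin m} (hγr : γ * v i j ≤ r j) (hrv : r j ≤ v i j)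
    {T : (Fin m → ℝ) → Fin m → ℝ} (hT : ∀ β, T β j = v i j) (b : Fin n → Fin m → ℝ) :
    v i j ≤ (1 - γ) * valij v (deviate i T b) r i j + ∑ i', payij v b r i' j
      + v i j * {b | Unsold b r j}.indicator 1 b := by
  have hpay : 0 ≤ ∑ i', payij v b r i' j := sum_nonneg fun i' _ => payij_nonneg hr b i' j
  by_cases hu : Unsold b r j
  · have := mul_nonneg (sub_nonneg.mpr hγ) (valij_nonneg (r := r) hv (deviate i T b) i j)
    simp only [Set.indicator, Set.mem_ofPred_eq, hu, if_true, Pi.one_apply]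
    linarith
  · simp only [Set.indicator, Set.mem_ofPred_eq, hu, if_false]
    by_cases hw : Wins v (deviate i T b) r j i
    · obtain ⟨w, hw'⟩ := exists_wins (v := v) hu
      have := hw'.1.trans (hw'.le_sum_payij hr)
      simp only [valij, xind, hw, if_true]
      linarith
    · have hval : valij v (deviate i T b) r i j = 0 := by simp [valij, xind, hw]
      have hex : ∃ i', i' ≠ i ∧ r j ≤ b i' j ∧ v i j ≤ b i' j := by
        by_contra! hcon
        refine hw ⟨by simpa [hT] using hrv, fun i' hne => ?_⟩
        rw [deviate_of_ne hne, deviate_self, hT]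
        rcases lt_or_ge (b i' j) (r j) with h | h
        · exact Or.inl h
        · exact Or.inr (Or.inl (hcon i' hne h))
      obtain ⟨i', -, h₁, h₂⟩ := hex
      have := h₂.trans (bid_le_sum_payij (v := v) hr h₁)
      rw [hval]
      linarith

/-- Raise the bid in auction `j₀` to the reserve, if it is below. -/
def raiseBid (r : Fin m → ℝ) (j₀ : Fin m) (β : Fin m → ℝ) : Fin m → ℝ :=
  Function.update β j₀ (max (β j₀) (r j₀))

lemma xind_raiseBid_of_ne {i : Fin n} {j₀ j : Fin m} (h : j ≠ j₀) (b : Fin n → Fin m → ℝ) :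
    xind v (deviate i (raiseBid r j₀) b) r j i = xind v b r j i := by
  refine xind_congr (fun i' => ?_) i
  rcases eq_or_ne i' i with rfl | hne
  · simp [raiseBid, h]
  · rw [deviate_of_ne hne]

lemma deviate_raiseBid_of_le {i : Fin n} {j₀ : Fin m} {b : Fin n → Fin m → ℝ}
    (h : r j₀ ≤ b i j₀) : deviate i (raiseBid r j₀) b = b := by
  simp [deviate, raiseBid, h]

lemma mul_indicator_unsold_le {i : Fin n} {j₀ : Fin m} (hv : ∀ i j, 0 ≤ v i j)
    (b : Fin n → Fin m → ℝ) :
    v i j₀ * {b | Unsold b r j₀}.indicator 1 b ≤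
      valij v (deviate i (raiseBid r j₀) b) r i j₀ - valij v b r i j₀ := by
  rcases le_or_gt (r j₀) (b i j₀) with h | h
  · have hu : ¬ Unsold b r j₀ := fun hu => absurd (hu i) (not_lt.mpr h)
    simp [deviate_raiseBid_of_le h, hu]
  · have hw : ¬ Wins v b r j₀ i := fun hw => absurd hw.1 (not_le.mpr h)
    have hval : valij v b r i j₀ = 0 := by simp [valij, xind, hw]
    rw [hval, sub_zero]
    by_cases hu : Unsold b r j₀
    · have hw' : Wins v (deviate i (raiseBid r j₀) b) r j₀ i :=
        ⟨by simp [raiseBid], fun i' hne => Or.inl (by rw [deviate_of_ne hne]; exact hu i')⟩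
      simp [valij, xind, hw', hu]
    · simpa [hu] using valij_nonneg hv _ i j₀

lemma payij_raiseBid_sub_le {i : Fin n} {j₀ : Fin m} (hrv : r j₀ ≤ v i j₀)
    (b : Fin n → Fin m → ℝ) (j : Fin m) :
    payij v (deviate i (raiseBid r j₀) b) r i j - payij v b r i j ≤
      valij v (deviate i (raiseBid r j₀) b) r i j - valij v b r i j := by
  rcases eq_or_ne j j₀ with rfl | hne
  · rcases le_or_gt (r j) (b i j) with h | h
    · simp [deviate_raiseBid_of_le h]
    · have hw : ¬ Wins v b r j i := fun hw => absurd hw.1 (not_le.mpr h)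
      have hx : xind v b r j i = 0 := by simp [xind, hw]
      simp only [payij, valij, hx, zero_mul, sub_zero, deviate_self, raiseBid,
        Function.update_self, max_eq_right h.le]
      exact mul_le_mul_of_nonneg_left hrv (xind_nonneg _ _ _)
  · simp [payij, valij, xind_raiseBid_of_ne hne, raiseBid, hne]

lemma measurableSet_wins (j : Fin m) (i : Fin n) : MeasurableSet {b | Wins v b r j i} := by
  simp only [Wins, Set.ofPred_and, Set.ofPred_or, Set.ofPred_forall]
  refine MeasurableSet.inter (measurableSet_le (by fun_prop) (by fun_prop)) ?_
  refine MeasurableSet.iInter fun i' => MeasurableSet.iInter fun _ => ?_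
  refine MeasurableSet.union (measurableSet_lt (by fun_prop) (by fun_prop)) ?_
  refine MeasurableSet.union (measurableSet_lt (by fun_prop) (by fun_prop)) ?_
  exact MeasurableSet.inter (measurableSet_eq_fun (by fun_prop) (by fun_prop))
    (by measurability)

lemma measurable_xind (j : Fin m) (i : Fin n) : Measurable fun b => xind v b r j i :=
  Measurable.ite (measurableSet_wins j i) measurable_const measurable_const

lemma measurableSet_unsold (j : Fin m) :
    MeasurableSet {b : Fin n → Fin m → ℝ | Unsold b r j} := by
  simp only [Unsold, Set.ofPred_forall]
  exact MeasurableSet.iInter fun i => measurableSet_lt (by fun_prop) (by fun_prop)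

lemma norm_xind_le_one (b : Fin n → Fin m → ℝ) (j : Fin m) (i : Fin n) :
    ‖xind v b r j i‖ ≤ 1 := by
  rw [Real.norm_of_nonneg (xind_nonneg b j i)]
  exact xind_le_one b j i

lemma integrable_valij (hμ : ∀ i, Admissible (μ i)) (i : Fin n) (j : Fin m) :
    Integrable (fun b => valij v b r i j) (Measure.pi μ) := by
  have := fun i => (hμ i).1
  exact (integrable_const (v i j)).bdd_mul (measurable_xind j i).aestronglyMeasurable
    (ae_of_all _ fun b => norm_xind_le_one b j i)

lemma integrable_payij (hμ : ∀ i, Admissible (μ i)) (i : Fin n) (j : Fin m) :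
    Integrable (fun b => payij v b r i j) (Measure.pi μ) := by
  have := fun i => (hμ i).1
  exact ((measurePreserving_eval μ i).integrable_comp_of_integrable ((hμ i).2.2 j)).bdd_mul
    (measurable_xind j i).aestronglyMeasurable (ae_of_all _ fun b => norm_xind_le_one b j i)

lemma measurable_deviate (i : Fin n) {T : (Fin m → ℝ) → Fin m → ℝ} (hT : Measurable T) :
    Measurable (deviate i T) := by
  refine measurable_pi_lambda _ fun i' => ?_
  rcases eq_or_ne i' i with rfl | hne
  · simpa [deviate, Function.comp_def] using hT.comp (measurable_pi_apply i')
  · simpa [deviate, hne] using measurable_pi_apply i'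

lemma pi_deviateStrategy (hμ : ∀ i, Admissible (μ i)) (i : Fin n)
    {T : (Fin m → ℝ) → Fin m → ℝ} (hT : Measurable T) :
    Measure.pi (deviateStrategy i T μ) = (Measure.pi μ).map (deviate i T) := by
  have := fun i => (hμ i).1
  let f : Fin n → (Fin m → ℝ) → Fin m → ℝ := Function.update (fun _ => id) i T
  have hf : ∀ i', Measurable (f i') := by
    intro i'
    rcases eq_or_ne i' i with rfl | hne
    · simpa [f] using hT
    · simpa [f, hne] using measurable_id
  have := fun i' => Measure.isProbabilityMeasure_map (μ := μ i') (hf i').aemeasurable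
  have hdev : deviate i T = fun b i' => f i' (b i') := by
    funext b i'
    rcases eq_or_ne i' i with rfl | hne
    · simp [f, deviate]
    · simp [f, deviate, hne]
  have hstr : deviateStrategy i T μ = fun i' => (μ i').map (f i') := by
    funext i'
    rcases eq_or_ne i' i with rfl | hne
    · simp [f, deviateStrategy]
    · simp [f, deviateStrategy, hne]
  rw [hdev, hstr, Measure.pi_map_pi fun i' => (hf i').aemeasurable]

lemma Admissible.map {σ : Measure (Fin m → ℝ)} (hσ : Admissible σ)
    {T : (Fin m → ℝ) → Fin m → ℝ} (hT : Measurable T)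
    (hnn : ∀ β, (∀ j, 0 ≤ β j) → ∀ j, 0 ≤ T β j)
    (hint : ∀ j, Integrable (fun β => T β j) σ) : Admissible (σ.map T) := by
  have := hσ.1
  refine ⟨Measure.isProbabilityMeasure_map hT.aemeasurable, ?_, fun j => ?_⟩
  · rw [ae_map_iff hT.aemeasurable
      (by simp only [Set.ofPred_forall]
          exact MeasurableSet.iInter fun j => measurableSet_le (by fun_prop) (by fun_prop))]
    exact hσ.2.1.mono hnn
  · exact (integrable_map_measure (measurable_pi_apply j).aestronglyMeasurable hT.aemeasurable).mpr (hint j)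

lemma admissible_deviateStrategy (hμ : ∀ i, Admissible (μ i)) {i : Fin n}
    {T : (Fin m → ℝ) → Fin m → ℝ} (hadm : Admissible ((μ i).map T)) (i' : Fin n) :
    Admissible (deviateStrategy i T μ i') := by
  rcases eq_or_ne i' i with rfl | hne
  · simpa [deviateStrategy] using hadm
  · simpa [deviateStrategy, hne] using hμ i'

section Deviation

variable {i : Fin n} {T : (Fin m → ℝ) → Fin m → ℝ}

lemma integrable_valij_deviate (hμ : ∀ i, Admissible (μ i)) (hT : Measurable T)
    (hadm : Admissible ((μ i).map T)) (j : Fin m) :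
    Integrable (fun b => valij v (deviate i T b) r i j) (Measure.pi μ) := by
  have h := integrable_valij (v := v) (r := r) (admissible_deviateStrategy hμ hadm) i j
  rw [pi_deviateStrategy hμ i hT] at h
  exact h.comp_measurable (measurable_deviate i hT)

lemma integrable_payij_deviate (hμ : ∀ i, Admissible (μ i)) (hT : Measurable T)
    (hadm : Admissible ((μ i).map T)) (j : Fin m) :
    Integrable (fun b => payij v (deviate i T b) r i j) (Measure.pi μ) := by
  have h := integrable_payij (v := v) (r := r) (admissible_deviateStrategy hμ hadm) i j
  rw [pi_deviateStrategy hμ i hT] at h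
  exact h.comp_measurable (measurable_deviate i hT)

lemma EValij_deviateStrategy (hμ : ∀ i, Admissible (μ i)) (hT : Measurable T) (j : Fin m) :
    EValij v r (deviateStrategy i T μ) i j =
      ∫ b, valij v (deviate i T b) r i j ∂(Measure.pi μ) := by
  rw [EValij, pi_deviateStrategy hμ i hT]
  exact integral_map (measurable_deviate i hT).aemeasurable
    ((measurable_xind j i).mul_const _).aestronglyMeasurable

lemma EPayij_deviateStrategy (hμ : ∀ i, Admissible (μ i)) (hT : Measurable T) (j : Fin m) :
    EPayij v r (deviateStrategy i T μ) i j =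
      ∫ b, payij v (deviate i T b) r i j ∂(Measure.pi μ) := by
  rw [EPayij, pi_deviateStrategy hμ i hT]
  exact integral_map (measurable_deviate i hT).aemeasurable
    ((measurable_xind j i).mul (by fun_prop)).aestronglyMeasurable

end Deviation

lemma EValij_nonneg (hv : ∀ i j, 0 ≤ v i j) (i : Fin n) (j : Fin m) : 0 ≤ EValij v r μ i j :=
  integral_nonneg fun b => valij_nonneg hv b i j

/-- Under a best response of a value maximizer, an auction whose reserve is at most its positive
value is almost surely sold. -/
lemma ValBest.mul_unsold_nonpos (hμ : ∀ i, Admissible (μ i)) (hv : ∀ i j, 0 ≤ v i j)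
    {i : Fin n} (h : ValBest v r μ i) {j₀ : Fin m} (hrv : r j₀ ≤ v i j₀) :
    ∫ b, v i j₀ * {b | Unsold b r j₀}.indicator 1 b ∂(Measure.pi μ) ≤ 0 := by
  have := fun i => (hμ i).1
  have hT : Measurable (raiseBid r j₀) := by
    unfold raiseBid
    refine measurable_pi_lambda _ fun j => ?_
    rcases eq_or_ne j j₀ with rfl | hne
    · simpa using (measurable_pi_apply j).max measurable_const
    · simpa [hne] using measurable_pi_apply j
  have hadm : Admissible ((μ i).map (raiseBid r j₀)) := by
    refine (hμ i).map hT (fun β hβ j => ?_) fun j => ?_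
    · rcases eq_or_ne j j₀ with rfl | hne
      · simpa [raiseBid] using Or.inl (hβ j)
      · simpa [raiseBid, hne] using hβ j
    · rcases eq_or_ne j j₀ with rfl | hne
      · simpa [raiseBid, Pi.sup_def] using ((hμ i).2.2 j).sup (integrable_const (r j))
      · simpa [raiseBid, hne] using (hμ i).2.2 j
  have hVint := integrable_valij_deviate (v := v) (r := r) hμ hT hadm
  have hPint := integrable_payij_deviate (v := v) (r := r) hμ hT hadm
  have hV := integrable_valij (v := v) (r := r) hμ i
  have hP := integrable_payij (v := v) (r := r) hμ i
  set μ' := deviateStrategy i (raiseBid r j₀) μ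
  have hgain : ∀ j, EPayij v r μ' i j - EPayij v r μ i j ≤
      EValij v r μ' i j - EValij v r μ i j := fun j => by
    rw [EPayij_deviateStrategy hμ hT, EValij_deviateStrategy hμ hT, EPayij, EValij,
      ← integral_sub (hPint j) (hP j), ← integral_sub (hVint j) (hV j)]
    exact integral_mono ((hPint j).sub (hP j)) ((hVint j).sub (hV j))
      fun b => payij_raiseBid_sub_le hrv b j
  have hroi : EPay v r μ' i ≤ EVal v r μ' i := by
    have := Finset.sum_le_sum fun j (_ : j ∈ univ) => hgain j
    simp only [Finset.sum_sub_distrib] at this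
    have := h.1
    unfold EPay EVal at *
    linarith
  have hbest : EVal v r μ' i ≤ EVal v r μ i := h.2 _ hadm hroi
  have hother : ∀ j, j ≠ j₀ → EValij v r μ' i j = EValij v r μ i j := fun j hj => by
    rw [EValij_deviateStrategy hμ hT]
    simp only [EValij, valij, xind_raiseBid_of_ne hj]
  have hj₀ : EValij v r μ' i j₀ ≤ EValij v r μ i j₀ := by
    unfold EVal at hbest
    rw [← Finset.add_sum_erase univ _ (mem_univ j₀), ← Finset.add_sum_erase univ _ (mem_univ j₀),
      Finset.sum_congr rfl fun j hj => hother j (ne_of_mem_erase hj)] at hbest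
    linarith
  calc ∫ b, v i j₀ * {b | Unsold b r j₀}.indicator 1 b ∂(Measure.pi μ)
      ≤ ∫ b, (valij v (deviate i (raiseBid r j₀) b) r i j₀ - valij v b r i j₀)
          ∂(Measure.pi μ) :=
        integral_mono
          (((integrable_const 1).indicator (measurableSet_unsold j₀)).const_mul _)
          ((hVint j₀).sub (hV j₀)) fun b => mul_indicator_unsold_le hv b
    _ = EValij v r μ' i j₀ - EValij v r μ i j₀ := by
        rw [integral_sub (hVint j₀) (hV j₀), EValij_deviateStrategy hμ hT, EValij]
    _ ≤ 0 := sub_nonpos.mpr hj₀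

/-- The value of a best-responding value maximizer, discounted by `1 - γ`, and the revenue of a
set `J` of auctions whose reserves are between `γ` times its value and its value, cover its
total value for `J`. -/
lemma ValBest.sum_le (hμ : ∀ i, Admissible (μ i)) (hv : ∀ i j, 0 ≤ v i j) (hr : ∀ j, 0 ≤ r j)
    {i : Fin n} (h : ValBest v r μ i) {γ : ℝ} (hγ : γ ≤ 1) {J : Finset (Fin m)}
    (hγr : ∀ j ∈ J, γ * v i j ≤ r j) (hrv : ∀ j ∈ J, r j ≤ v i j) :
    ∑ j ∈ J, v i j ≤ (1 - γ) * EVal v r μ i + ∑ j ∈ J, ∑ i', EPayij v r μ i' j := by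
  have := fun i => (hμ i).1
  let T : (Fin m → ℝ) → Fin m → ℝ := fun _ j => if j ∈ J then v i j else 0
  have hT : Measurable T := measurable_const
  have hadm : Admissible ((μ i).map T) :=
    (hμ i).map hT (fun _ _ j => by dsimp only [T]; split_ifs; exacts [hv i j, le_rfl])
      fun j => integrable_const _
  have hVint := integrable_valij_deviate (v := v) (r := r) hμ hT hadm
  have hPint := integrable_payij_deviate (v := v) (r := r) hμ hT hadm
  have hP := integrable_payij (v := v) (r := r) hμ
  set μ' := deviateStrategy i T μ
  have hroi : EPay v r μ' i ≤ EVal v r μ' i := by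
    refine Finset.sum_le_sum fun j _ => ?_
    rw [EPayij_deviateStrategy hμ hT, EValij_deviateStrategy hμ hT]
    refine integral_mono (hPint j) (hVint j) fun b =>
      mul_le_mul_of_nonneg_left ?_ (xind_nonneg _ _ _)
    rw [deviate_self]
    dsimp only [T]
    split_ifs
    exacts [le_rfl, hv i j]
  have hbest : ∑ j ∈ J, EValij v r μ' i j ≤ EVal v r μ i :=
    (Finset.sum_le_univ_sum_of_nonneg fun j => EValij_nonneg hv i j).trans (h.2 _ hadm hroi)
  have hcover : ∀ j ∈ J, v i j ≤
      (1 - γ) * EValij v r μ' i j + ∑ i', EPayij v r μ i' j := fun j hj => by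
    have hU : Integrable (fun b => v i j * {b | Unsold b r j}.indicator 1 b) (Measure.pi μ) :=
      ((integrable_const 1).indicator (measurableSet_unsold j)).const_mul _
    have hsum := integrable_finsetSum univ fun i' _ => hP i' j
    have hmono := integral_mono (integrable_const (v i j))
      ((((hVint j).const_mul (1 - γ)).add hsum).add hU)
      fun b => le_valij_deviate_add_sum_payij hγ hv hr (hγr j hj) (hrv j hj)
        (T := T) (fun _ => if_pos hj) b
    rw [integral_add' (((hVint j).const_mul (1 - γ)).add hsum) hU,
      integral_add' ((hVint j).const_mul (1 - γ)) hsum, integral_const_mul,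
      integral_finsetSum _ fun i' _ => hP i' j, integral_const, probReal_univ, one_smul,
      ← EValij_deviateStrategy hμ hT] at hmono
    have := h.mul_unsold_nonpos hμ hv (hrv j hj)
    unfold EPayij
    linarith
  calc ∑ j ∈ J, v i j
      ≤ ∑ j ∈ J, ((1 - γ) * EValij v r μ' i j + ∑ i', EPayij v r μ i' j) :=
        Finset.sum_le_sum hcover
    _ = (1 - γ) * ∑ j ∈ J, EValij v r μ' i j + ∑ j ∈ J, ∑ i', EPayij v r μ i' j := by
        rw [Finset.sum_add_distrib, Finset.mul_sum]
    _ ≤ _ := by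
        gcongr

lemma sup'_eq_rwinner [NeZero n] (v : Fin n → Fin m → ℝ) (j : Fin m) :
    (Finset.univ.sup' Finset.univ_nonempty fun i => v i j) = v (rwinner v j) j := by
  have h : rwinner v j ∈ univ.filter fun i => ∀ i', v i' j ≤ v i j := Finset.min'_mem _ _
  exact le_antisymm (Finset.sup'_le _ _ fun i _ => (mem_filter.mp h).2 i)
    (Finset.le_sup' (fun i => v i j) (mem_univ _))

end FPAR

/-- Lemma 7 of the paper. In any equilibrium of the first-price
auction with machine-learned reserves of accuracy `γ ∈ [0,1]`:
`(1 - γ) · Σ_{i ∈ B_v} E[val i] + Σ_{i, j : rw(j) ∈ B_v} E[p i j] ≥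
 Σ_{j : rw(j) ∈ B_v} max_i v i j`. -/
theorem fpa_ml_reserves_value_lemma {n m : ℕ} [NeZero n]
    (γ : ℝ) (hγ : γ ∈ Set.Icc (0 : ℝ) 1)
    (v : Fin n → Fin m → ℝ) (hv : ∀ i j, 0 ≤ v i j)
    (r : Fin m → ℝ)
    (hr : ∀ j, γ * (Finset.univ.sup' Finset.univ_nonempty fun i => v i j) ≤ r j ∧
      r j ≤ Finset.univ.sup' Finset.univ_nonempty fun i => v i j)
    (Bu Bv : Finset (Fin n)) (hdisj : Disjoint Bu Bv) (hcover : Bu ∪ Bv = Finset.univ)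
    (μ : Fin n → Measure (Fin m → ℝ))
    (heq : FPAR.Equilibrium v r Bu Bv μ) :
    (1 - γ) * (∑ i ∈ Bv, FPAR.EVal v r μ i) +
        ∑ i : Fin n, ∑ j ∈ Finset.univ.filter (fun j => FPAR.rwinner v j ∈ Bv),
          FPAR.EPayij v r μ i j ≥
      ∑ j ∈ Finset.univ.filter (fun j => FPAR.rwinner v j ∈ Bv),
        Finset.univ.sup' Finset.univ_nonempty fun i => v i j := by
  simp only [FPAR.sup'_eq_rwinner] at hr ⊢
  have hr0 : ∀ j, 0 ≤ r j := fun j => (mul_nonneg hγ.1 (hv _ j)).trans (hr j).1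
  have hfiber : ∀ f : Fin m → ℝ,
      ∑ j ∈ Finset.univ.filter (fun j => FPAR.rwinner v j ∈ Bv), f j =
        ∑ i ∈ Bv, ∑ j ∈ Finset.univ.filter (fun j => FPAR.rwinner v j = i), f j := fun f => by
    rw [← Finset.sum_fiberwise_of_maps_to (g := FPAR.rwinner v)
      fun j hj => (mem_filter.mp hj).2]
    refine Finset.sum_congr rfl fun i hi => ?_
    rw [Finset.filter_filter]
    refine Finset.sum_congr (Finset.filter_congr fun j _ => ?_) fun _ _ => rfl
    exact ⟨fun h => h.2, fun h => ⟨h ▸ hi, h⟩⟩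
  rw [Finset.sum_comm, hfiber, hfiber, Finset.mul_sum, ← Finset.sum_add_distrib]
  refine Finset.sum_le_sum fun i hi => ?_
  rw [Finset.sum_congr rfl fun j hj => by rw [(mem_filter.mp hj).2]]
  exact (heq.2.2 i hi).sum_le heq.1 hv hr0 hγ.2
    (fun j hj => (mem_filter.mp hj).2 ▸ (hr j).1) fun j hj => (mem_filter.mp hj).2 ▸ (hr j).2
end

section
/- The infimum over all reals V₁ ≥ 0, V₂ ≥ 0 with V₁ + V₂ > 0 and all x, y ∈ [0,1] of the quantity ( max{ x·V₁, (1 − x)·V₁ + (1 − y + y·ln y)·V₂ } + y·V₂ ) / (V₁ + V₂) equals the minimum over y ∈ [0,1] of (1 + y·ln y) / (2 − y + y·ln y). (Here y·ln y is extended by the convention 0·ln 0 = 0; in particular both the infimum and the minimum are attained and equal ≈ 0.457.) -/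
/-- The set of objective values in the optimization of Lemma 9 of the paper
(with the convention `0 · ln 0 = 0`, which holds since `Real.log 0 = 0`). -/
def lemmaMaxSet : Set ℝ :=
  {z | ∃ V₁ V₂ x y : ℝ, 0 ≤ V₁ ∧ 0 ≤ V₂ ∧ 0 < V₁ + V₂ ∧
    x ∈ Set.Icc (0 : ℝ) 1 ∧ y ∈ Set.Icc (0 : ℝ) 1 ∧
    z = (max (x * V₁) ((1 - x) * V₁ + (1 - y + y * Real.log y) * V₂) + y * V₂) /
      (V₁ + V₂)}

/-- The set of values `(1 + y ln y)/(2 - y + y ln y)` for `y ∈ [0,1]`. -/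
def lemmaMinSet : Set ℝ :=
  (fun y : ℝ => (1 + y * Real.log y) / (2 - y + y * Real.log y)) '' Set.Icc 0 1

theorem sub_one_le_mul_log {y : ℝ} (hy : 0 ≤ y) : y - 1 ≤ y * Real.log y := by
  rcases hy.eq_or_lt with rfl | hy
  · simp
  · have h := mul_le_mul_of_nonneg_left (Real.one_sub_inv_le_log_of_pos hy) hy.le
    rwa [mul_sub, mul_inv_cancel₀ hy.ne', mul_one] at h

theorem exists_isLeast_lemmaMinSet : ∃ m, IsLeast lemmaMinSet m := by
  have hc : ContinuousOn (fun y : ℝ => (1 + y * Real.log y) / (2 - y + y * Real.log y))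
      (Set.Icc 0 1) := by
    have hlog := Real.continuous_mul_log
    refine ContinuousOn.div (continuous_const.add hlog).continuousOn
      ((continuous_const.sub continuous_id).add hlog).continuousOn fun y hy => ?_
    linarith [sub_one_le_mul_log hy.1]
  exact (isCompact_Icc.image_of_continuousOn hc).exists_isLeast
    ((Set.nonempty_Icc.2 zero_le_one).image _)

/-- The substitution `V₁ = 1 - y + y ln y`, `V₂ = 1`, `x = 1` balances the maximum. -/
theorem lemmaMinSet_subset_lemmaMaxSet : lemmaMinSet ⊆ lemmaMaxSet := by
  rintro _ ⟨y, hy, rfl⟩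
  have hg := sub_one_le_mul_log hy.1
  refine ⟨1 - y + y * Real.log y, 1, 1, y, by linarith, zero_le_one, by linarith,
    by simp, hy, ?_⟩
  have hmax : max (1 * (1 - y + y * Real.log y))
      ((1 - 1) * (1 - y + y * Real.log y) + (1 - y + y * Real.log y) * 1)
      = 1 - y + y * Real.log y := by simp
  rw [hmax]
  ring

/-- If `V₁ ≥ g V₂` compare the maximum with the average of its arguments, otherwise with
`g V₂`, where `g = 1 - y + y ln y`. -/
theorem mem_lowerBounds_lemmaMaxSet {m : ℝ} (hm : m ∈ lowerBounds lemmaMinSet) :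
    m ∈ lowerBounds lemmaMaxSet := by
  rintro _ ⟨V₁, V₂, x, y, h₁, h₂, hV, hx, hy, rfl⟩
  have hhalf : m ≤ 1 / 2 := hm ⟨0, by simp, by simp⟩
  have hg := sub_one_le_mul_log hy.1
  have hmy : m ≤ (1 + y * Real.log y) / (2 - y + y * Real.log y) := hm ⟨y, hy, rfl⟩
  rw [le_div_iff₀ (by linarith)] at hmy
  rw [le_div_iff₀ hV]
  obtain ⟨g, hgy⟩ : ∃ g, g = 1 - y + y * Real.log y := ⟨_, rfl⟩
  rw [← hgy]
  have hg0 : 0 ≤ g := by linarith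
  have hmg : m * (1 + g) ≤ g + y := by rw [hgy]; linarith
  have hleft := le_max_left (x * V₁) ((1 - x) * V₁ + g * V₂)
  have hright := le_max_right (x * V₁) ((1 - x) * V₁ + g * V₂)
  have hmul := mul_le_mul_of_nonneg_right hmg h₂
  rcases le_total (g * V₂) V₁ with h | h
  · nlinarith [mul_nonneg (sub_nonneg.2 hhalf) (sub_nonneg.2 h)]
  · have hxV := mul_nonneg (sub_nonneg.2 hx.2) h₁
    rcases le_total 0 m with hm0 | hm0
    · nlinarith [mul_le_mul_of_nonneg_left h hm0]
    · nlinarith [mul_nonneg hg0 h₂, mul_nonneg hy.1 h₂,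
        mul_nonneg (neg_nonneg.2 hm0) hV.le]

/-- Lemma 9 of the paper. The infimum of the optimization equals
`min_{y ∈ [0,1]} (1 + y ln y)/(2 - y + y ln y) ≈ 0.457`, and both the infimum and the
minimum are attained. -/
theorem lemma_max_value :
    sInf lemmaMaxSet = sInf lemmaMinSet ∧
    sInf lemmaMaxSet ∈ lemmaMaxSet ∧ sInf lemmaMinSet ∈ lemmaMinSet := by
  obtain ⟨m, hm⟩ := exists_isLeast_lemmaMinSet
  have hm' : IsLeast lemmaMaxSet m :=
    ⟨lemmaMinSet_subset_lemmaMaxSet hm.1, mem_lowerBounds_lemmaMaxSet hm.2⟩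
  rw [hm.csInf_eq, hm'.csInf_eq]
  exact ⟨rfl, hm'.1, hm.1⟩
end

section
/- For every γ ∈ [0,1), the infimum over all reals V₁ ≥ 0, V₂ ≥ 0 with V₁ + V₂ > 0 and all x, y ∈ [0,1] of the quantity ( max{ x·V₁, (1 − (1−γ)·x)·V₁ + (1 − y + (1−γ)·y·ln y)·V₂ } + y·V₂ ) / (V₁ + V₂) equals the minimum over y ∈ [0,1] of (1 + y·ln y − γ·y·(1 + ln y)) / (2 − y − γ + (1−γ)·y·ln y). -/
/-- The set of objective values in the optimization of Lemma 10 of the paper, for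
accuracy `γ` (with the convention `0 · ln 0 = 0`, which holds since `Real.log 0 = 0`). -/
def lemmaMaxSetML (γ : ℝ) : Set ℝ :=
  {z | ∃ V₁ V₂ x y : ℝ, 0 ≤ V₁ ∧ 0 ≤ V₂ ∧ 0 < V₁ + V₂ ∧
    x ∈ Set.Icc (0 : ℝ) 1 ∧ y ∈ Set.Icc (0 : ℝ) 1 ∧
    z = (max (x * V₁)
        ((1 - (1 - γ) * x) * V₁ + (1 - y + (1 - γ) * (y * Real.log y)) * V₂) +
        y * V₂) / (V₁ + V₂)}

/-- The set of values `(1 + y ln y - γ y (1 + ln y)) / (2 - y - γ + (1 - γ) y ln y)`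
for `y ∈ [0,1]`. -/
def lemmaMinSetML (γ : ℝ) : Set ℝ :=
  (fun y : ℝ =>
    (1 + y * Real.log y - γ * (y * (1 + Real.log y))) /
      (2 - y - γ + (1 - γ) * (y * Real.log y))) '' Set.Icc 0 1

/-- The lower bound for the objective, with `B = 1 - y + c * (y * log y)` and `c = 1 - γ`. -/
theorem mul_add_le_max_add {c m B V₁ V₂ x y : ℝ} (hc : 0 < c) (hB : 0 ≤ B)
    (hBy : 1 - c ≤ B + y) (hV₁ : 0 ≤ V₁) (hV₂ : 0 ≤ V₂) (hx : x ≤ 1)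
    (hm : m * (B + c) ≤ B + c * y) (hm' : m * (1 + c) ≤ 1) :
    m * (V₁ + V₂) ≤ max (x * V₁) ((1 - c * x) * V₁ + B * V₂) + y * V₂ := by
  set M := max (x * V₁) ((1 - c * x) * V₁ + B * V₂)
  have hM₁ : x * V₁ ≤ M := le_max_left _ _
  have hM₂ : (1 - c * x) * V₁ + B * V₂ ≤ M := le_max_right _ _
  rcases le_total (B * V₂) (c * V₁) with h | h
  · have hM : V₁ + B * V₂ ≤ (1 + c) * M := by
      linarith [mul_le_mul_of_nonneg_left hM₁ hc.le]
    have hmV₂ := mul_le_mul_of_nonneg_left hm (mul_nonneg (add_nonneg zero_le_one hc.le) hV₂)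
    have hmV₁ := mul_le_mul_of_nonneg_left hm' (sub_nonneg.2 h)
    have hcM := mul_le_mul_of_nonneg_left hM hc.le
    refine le_of_mul_le_mul_left ?_ (mul_pos hc (add_pos one_pos hc))
    linarith
  · have hM : (1 - c) * V₁ + B * V₂ ≤ M := by
      linarith [mul_le_mul_of_nonneg_left hx (mul_nonneg hc.le hV₁)]
    have hmB : m ≤ B + y := by
      refine le_of_mul_le_mul_right ?_ (add_pos_of_nonneg_of_pos hB hc)
      linarith [mul_le_mul_of_nonneg_left hBy hB]
    rcases hB.eq_or_lt with rfl | hB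
    · obtain rfl : V₁ = 0 := by nlinarith
      linarith [mul_le_mul_of_nonneg_right hmB hV₂]
    · have hmV₁ := mul_le_mul_of_nonneg_left hm hV₁
      have hmV₂ := mul_le_mul_of_nonneg_left hmB (sub_nonneg.2 h)
      have hBM := mul_le_mul_of_nonneg_left hM hB.le
      refine le_of_mul_le_mul_left ?_ hB
      linarith

theorem denominator_pos {γ y : ℝ} (hγ0 : 0 ≤ γ) (hγ1 : γ < 1) (hy : y ∈ Set.Icc (0 : ℝ) 1) :
    0 < 2 - y - γ + (1 - γ) * (y * Real.log y) := by
  nlinarith [sub_one_le_mul_log hy.1, hy.2]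

theorem isCompact_lemmaMinSetML {γ : ℝ} (hγ0 : 0 ≤ γ) (hγ1 : γ < 1) :
    IsCompact (lemmaMinSetML γ) := by
  refine isCompact_Icc.image_of_continuousOn (ContinuousOn.div ?_ ?_ ?_)
  · have h : (fun y : ℝ => 1 + y * Real.log y - γ * (y * (1 + Real.log y))) =
        fun y : ℝ => 1 + y * Real.log y - γ * (y + y * Real.log y) := by
      funext y
      ring
    rw [h]
    have := Real.continuous_mul_log
    fun_prop
  · have := Real.continuous_mul_log
    fun_prop
  · exact fun y hy => (denominator_pos hγ0 hγ1 hy).ne'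

theorem lemmaMinSetML_subset_lemmaMaxSetML {γ : ℝ} (hγ0 : 0 ≤ γ) (hγ1 : γ < 1) :
    lemmaMinSetML γ ⊆ lemmaMaxSetML γ := by
  rintro _ ⟨y, hy, rfl⟩
  have hpos := denominator_pos hγ0 hγ1 hy
  refine ⟨1 - y + (1 - γ) * (y * Real.log y), 1 - γ, 1, y, ?_, by linarith, by linarith,
    by simp, hy, ?_⟩
  · nlinarith [sub_one_le_mul_log hy.1, hy.2]
  · rw [max_eq_left (le_of_eq (by ring))]
    ring

theorem le_of_mem_lemmaMaxSetML {γ m z : ℝ} (hγ0 : 0 ≤ γ) (hγ1 : γ < 1)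
    (hm : m ∈ lowerBounds (lemmaMinSetML γ)) (hz : z ∈ lemmaMaxSetML γ) : m ≤ z := by
  obtain ⟨V₁, V₂, x, y, hV₁, hV₂, hV, hx, hy, rfl⟩ := hz
  have hlog := sub_one_le_mul_log hy.1
  have hm₀ := hm ⟨0, by simp, rfl⟩
  have hm_y := hm ⟨y, hy, rfl⟩
  rw [le_div_iff₀ (denominator_pos hγ0 hγ1 (by simp))] at hm₀
  rw [le_div_iff₀ (denominator_pos hγ0 hγ1 hy)] at hm_y
  rw [le_div_iff₀ hV]
  refine mul_add_le_max_add (sub_pos.2 hγ1) ?_ ?_ hV₁ hV₂ hx.2 ?_ ?_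
  · nlinarith [hy.2]
  · nlinarith [hy.1]
  · linarith
  · simp only [zero_mul, mul_zero] at hm₀
    linarith

/-- Lemma 10 of the paper. For every `γ ∈ [0,1)`, the infimum of
the optimization equals
`min_{y ∈ [0,1]} (1 + y ln y - γ y (1 + ln y)) / (2 - y - γ + (1 - γ) y ln y)`. -/
theorem lemma_max_value_ml (γ : ℝ) (hγ0 : 0 ≤ γ) (hγ1 : γ < 1) :
    sInf (lemmaMaxSetML γ) = sInf (lemmaMinSetML γ) ∧
    sInf (lemmaMinSetML γ) ∈ lemmaMinSetML γ := by
  have hcompact := isCompact_lemmaMinSetML hγ0 hγ1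
  have hne : (lemmaMinSetML γ).Nonempty := (Set.nonempty_Icc.2 zero_le_one).image _
  have hsub := lemmaMinSetML_subset_lemmaMaxSetML hγ0 hγ1
  have hmem := hcompact.sInf_mem hne
  have hleast : IsLeast (lemmaMaxSetML γ) (sInf (lemmaMinSetML γ)) :=
    ⟨hsub hmem, fun _ hz => le_of_mem_lemmaMaxSetML hγ0 hγ1
      (fun _ hw => csInf_le hcompact.bddBelow hw) hz⟩
  exact ⟨hleast.csInf_eq, hmem⟩
end

section
/- For every fixed t ∈ [0,1), the function γ ↦ (1 + t·ln t − γ·t·(1 + ln t)) / (2 − t − γ + (1−γ)·t·ln t) is monotone nondecreasing on [0,1]; in particular its denominator 2 − t − γ + (1−γ)·t·ln t is positive for all t ∈ [0,1) and γ ∈ [0,1]. (Here t·ln t and t·(1 + ln t) are extended by the convention 0·ln 0 = 0.) -/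
/-- For every fixed `t ∈ [0,1)`, the function
`γ ↦ (1 + t ln t - γ t (1 + ln t)) / (2 - t - γ + (1 - γ) t ln t)` is monotone
nondecreasing on `[0,1]`, and its denominator is positive for all `γ ∈ [0,1]`
(with the convention `0 · ln 0 = 0`, which holds since `Real.log 0 = 0`). -/
theorem ml_bound_monotone (t : ℝ) (ht : t ∈ Set.Ico (0 : ℝ) 1) :
    (∀ γ ∈ Set.Icc (0 : ℝ) 1, 0 < 2 - t - γ + (1 - γ) * (t * Real.log t)) ∧
    MonotoneOn (fun γ : ℝ =>
      (1 + t * Real.log t - γ * (t * (1 + Real.log t))) /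
        (2 - t - γ + (1 - γ) * (t * Real.log t))) (Set.Icc 0 1) := by
  obtain ⟨ht0, ht1⟩ := ht
  have hL : 0 ≤ 1 + t * Real.log t := by
    rcases ht0.eq_or_lt with rfl | htpos
    · simp
    · have h := mul_le_mul_of_nonneg_left (Real.one_sub_inv_le_log_of_pos htpos) ht0
      rw [mul_sub, mul_one, mul_inv_cancel₀ htpos.ne'] at h
      linarith
  have hD : ∀ γ ∈ Set.Icc (0 : ℝ) 1, 0 < 2 - t - γ + (1 - γ) * (t * Real.log t) := by
    rintro γ ⟨-, hγ1⟩
    linarith [mul_nonneg (sub_nonneg.2 hγ1) hL]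
  refine ⟨hD, fun a ha b hb hab => ?_⟩
  dsimp only
  rw [div_le_div_iff₀ (hD a ha) (hD b hb)]
  linarith [mul_nonneg (sub_nonneg.2 hab) (sq_nonneg (1 - t))]
end

section
/- For all real numbers v > 0, 0 ≤ b < v, and x ∈ (0,1]: b·(1 − x) + ∫ from b to v − (v − b)·x of (1 − (v − b)·x/(v − s)) ds = (1 − x)·v + (v − b)·x·ln x, and consequently b·(1 − x) + ∫ from b to v − (v − b)·x of (1 − (v − b)·x/(v − s)) ds ≥ (1 − x + x·ln x)·v. -/
theorem integral_one_sub_const_div {p q : ℝ} (c : ℝ) (hp : 0 < p) (hq : 0 < q) :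
    ∫ u in p..q, (1 - c / u) = (q - p) - c * Real.log (q / p) := by
  have hint : IntervalIntegrable (fun u : ℝ => c * u⁻¹) MeasureTheory.volume p q :=
    (intervalIntegrable_inv_iff.mpr
      (Or.inr (Set.notMem_uIcc_of_lt hp hq))).const_mul c
  simp only [div_eq_mul_inv c]
  rw [intervalIntegral.integral_sub intervalIntegrable_const hint,
    intervalIntegral.integral_const_mul, integral_inv_of_pos hp hq]
  simp

/-- For `v > 0`, `0 ≤ b < v`, `x ∈ (0,1]`:
`b (1 - x) + ∫_b^{v - (v-b) x} (1 - (v-b) x/(v-s)) ds = (1 - x) v + (v - b) x ln x`,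
and consequently the left-hand side is at least `(1 - x + x ln x) v`. -/
theorem payment_lower_bound_integral (v b x : ℝ) (hv : 0 < v) (hb : 0 ≤ b)
    (hbv : b < v) (hx : x ∈ Set.Ioc (0 : ℝ) 1) :
    b * (1 - x) +
        (∫ s in b..(v - (v - b) * x), (1 - (v - b) * x / (v - s))) =
      (1 - x) * v + (v - b) * x * Real.log x ∧
    b * (1 - x) +
        (∫ s in b..(v - (v - b) * x), (1 - (v - b) * x / (v - s))) ≥
      (1 - x + x * Real.log x) * v := by
  obtain ⟨hx0, hx1⟩ := hx
  have hw : 0 < v - b := sub_pos.mpr hbv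
  have hratio : (v - b) / ((v - b) * x) = x⁻¹ := by
    field_simp
  have heq : b * (1 - x) +
      (∫ s in b..(v - (v - b) * x), (1 - (v - b) * x / (v - s))) =
      (1 - x) * v + (v - b) * x * Real.log x := by
    rw [intervalIntegral.integral_comp_sub_left (fun u => 1 - (v - b) * x / u) v,
      sub_sub_cancel, integral_one_sub_const_div _ (mul_pos hw hx0) hw, hratio, Real.log_inv]
    ring
  refine ⟨heq, ?_⟩
  have hlog : b * x * Real.log x ≤ 0 :=
    mul_nonpos_of_nonneg_of_nonpos (mul_nonneg hb hx0.le) (Real.log_nonpos hx0.le hx1)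
  rw [heq]
  linarith
end

section
/- With the convention 0·ln 0 = 0, the function f(t) = (1 + t·ln t)/(2 − t + t·ln t) on [0,1] satisfies: f(t) ≥ 0.45 for all t ∈ [0,1], and there exists t ∈ (0,1) with f(t) ≤ 0.458; in particular the minimum of f over [0,1] lies in [0.45, 0.458] (the paper reports it as ≈ 0.457), while f(0) = 1/2 and f(1) = 1. -/
/-- The tangent line of `t ↦ t * log t` at `c` lies below its graph. -/
theorem mul_log_tangent_le {c t : ℝ} (hc : 0 < c) (ht : 0 ≤ t) :
    t * (Real.log c + 1) - c ≤ t * Real.log t := by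
  rcases ht.eq_or_lt with rfl | ht
  · simpa using hc.le
  have h := mul_le_mul_of_nonneg_left (Real.log_le_sub_one_of_pos (div_pos hc ht)) ht.le
  rw [Real.log_div hc.ne' ht.ne', mul_sub t (c / t), mul_div_cancel₀ c ht.ne'] at h
  linarith

theorem log_six_le : Real.log 6 ≤ 9 / 5 := by
  have h : Real.log (6 ^ 5) ≤ 9 := by
    rw [Real.log_le_iff_le_exp (by norm_num)]
    calc (6 : ℝ) ^ 5 ≤ 2.718 ^ 9 := by norm_num
      _ ≤ Real.exp 1 ^ 9 := by
        gcongr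
        linarith [Real.exp_one_gt_d9]
      _ = Real.exp 9 := by rw [← Real.exp_nat_mul]; norm_num
  rw [Real.log_pow] at h
  push_cast at h
  linarith

theorem le_exp_neg_two : (0.135 : ℝ) ≤ Real.exp (-2) := by
  have h : Real.exp 2 ≤ 2.7183 ^ 2 := by
    calc Real.exp 2 = Real.exp 1 ^ 2 := by rw [← Real.exp_nat_mul]; norm_num
      _ ≤ 2.7183 ^ 2 := by
        gcongr
        linarith [Real.exp_one_lt_d9]
  rw [Real.exp_neg, le_inv_comm₀ (by norm_num) (Real.exp_pos 2)]
  exact h.trans (by norm_num)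

/-- With the convention `0 · ln 0 = 0` (which holds since
`Real.log 0 = 0`), the function `f t = (1 + t ln t)/(2 - t + t ln t)` on `[0,1]`
satisfies `f t ≥ 0.45` everywhere, dips below `0.458` somewhere in `(0,1)` (so its
minimum lies in `[0.45, 0.458]`, reported as `≈ 0.457`), while `f 0 = 1/2` and
`f 1 = 1`. -/
theorem poa_constant_bounds :
    (∀ t ∈ Set.Icc (0 : ℝ) 1,
      (0.45 : ℝ) ≤ (1 + t * Real.log t) / (2 - t + t * Real.log t)) ∧
    (∃ t ∈ Set.Ioo (0 : ℝ) 1,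
      (1 + t * Real.log t) / (2 - t + t * Real.log t) ≤ 0.458) ∧
    sInf ((fun t : ℝ => (1 + t * Real.log t) / (2 - t + t * Real.log t)) ''
        Set.Icc 0 1) ∈ Set.Icc (0.45 : ℝ) 0.458 ∧
    (1 + (0 : ℝ) * Real.log 0) / (2 - 0 + (0 : ℝ) * Real.log 0) = 1 / 2 ∧
    (1 + (1 : ℝ) * Real.log 1) / (2 - 1 + (1 : ℝ) * Real.log 1) = 1 := by
  have lower : ∀ t ∈ Set.Icc (0 : ℝ) 1,
      (0.45 : ℝ) ≤ (1 + t * Real.log t) / (2 - t + t * Real.log t) := by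
    rintro t ⟨h0, h1⟩
    have h_one := mul_log_tangent_le one_pos h0
    have h_sixth := mul_log_tangent_le (c := 6⁻¹) (by norm_num) h0
    rw [Real.log_one] at h_one
    rw [Real.log_inv] at h_sixth
    have h_six := mul_le_mul_of_nonneg_left log_six_le h0
    rw [le_div_iff₀ (by linarith)]
    linarith
  have upper : ∃ t ∈ Set.Ioo (0 : ℝ) 1,
      (1 + t * Real.log t) / (2 - t + t * Real.log t) ≤ 0.458 := by
    have h1 : Real.exp (-2) < 1 := Real.exp_lt_one_iff.2 (by norm_num)
    refine ⟨Real.exp (-2), ⟨Real.exp_pos _, h1⟩, ?_⟩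
    have h_tangent := mul_log_tangent_le one_pos (Real.exp_pos (-2)).le
    rw [Real.log_one] at h_tangent
    rw [div_le_iff₀ (by linarith), Real.log_exp]
    linarith [le_exp_neg_two]
  refine ⟨lower, upper, ⟨?_, ?_⟩, by norm_num, by norm_num⟩
  · refine le_csInf ((Set.nonempty_Icc.2 zero_le_one).image _) ?_
    rintro _ ⟨t, ht, rfl⟩
    exact lower t ht
  · obtain ⟨t, ht, hft⟩ := upper
    refine csInf_le_of_le ⟨0.45, ?_⟩ ⟨t, Set.Ioo_subset_Icc_self ht, rfl⟩ hft
    rintro _ ⟨s, hs, rfl⟩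
    exact lower s hs
end
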